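/- For every n ≥ 2, the polytope conv(QAP(n)) is 3-neighborly: every set of at most three distinct points of QAP(n) is the vertex set of a face of conv(QAP(n)). -/

import Mathlib

/-- The 0/1 permutation matrix of a permutation. -/
def permMat {n : ℕ} (σ : Equiv.Perm (Fin n)) : Fin n → Fin n → ℝ :=
  fun i j => if σ i = j then 1 else 0

/-- The quadratic assignment polytope vertex set: tensors `y ⊗ y` for permutation matrices. -/
def QAP (n : ℕ) : Set (Fin n → Fin n → Fin n → Fin n → ℝ) :=
  {y | ∃ σ : Equiv.Perm (Fin n), y = fun i j k l => permMat σ i j * permMat σ k l}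

/-- `F` is a face of `S`: either `S` itself, or the set of maximizers over `S`
of some linear functional. -/
def IsFaceOf {E : Type*} [AddCommGroup E] [Module ℝ E] (F S : Set E) : Prop :=
  F = S ∨ ∃ φ : E →ₗ[ℝ] ℝ, F = {x ∈ S | ∀ y ∈ S, φ y ≤ φ x}

/-- `S` is the vertex set of some face of `conv V`. -/
def IsVertexSetOfFace {E : Type*} [AddCommGroup E] [Module ℝ E]
    (V S : Set E) : Prop :=
  ∃ F, IsFaceOf F (convexHull ℝ V) ∧ F ∩ V = S

/-- A set `S` of points of a finite set `V` is the vertex set of a face of `conv V` as soon as every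
other point of `V` is cut off by a valid inequality that is tight on `S`. -/
theorem isVertexSetOfFace_of_forall_exists_lt {E : Type*} [AddCommGroup E] [Module ℝ E]
    {V S : Set E} (hV : V.Finite) (hSV : S ⊆ V) (hS : S.Nonempty)
    (h : ∀ x ∈ V \ S, ∃ (φ : E →ₗ[ℝ] ℝ) (c : ℝ),
      (∀ y ∈ V, φ y ≤ c) ∧ (∀ y ∈ S, φ y = c) ∧ φ x < c) :
    IsVertexSetOfFace V S := by
  choose! φ c hle heq hlt using h
  have hfin : (V \ S).Finite := hV.subset Set.sdiff_subset
  let Φ : E →ₗ[ℝ] ℝ := ∑ x ∈ hfin.toFinset, φ x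
  let C : ℝ := ∑ x ∈ hfin.toFinset, c x
  have hΦ (y : E) : Φ y = ∑ x ∈ hfin.toFinset, φ x y := by simp [Φ]
  have hΦV (y : E) (hy : y ∈ V) : Φ y ≤ C := by
    rw [hΦ]
    exact Finset.sum_le_sum fun x hx => hle x (hfin.mem_toFinset.1 hx) y hy
  have hΦS (y : E) (hy : y ∈ S) : Φ y = C := by
    rw [hΦ]
    exact Finset.sum_congr rfl fun x hx => heq x (hfin.mem_toFinset.1 hx) y hy
  have hΦlt (y : E) (hy : y ∈ V \ S) : Φ y < C := by
    rw [hΦ]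
    exact Finset.sum_lt_sum (fun x hx => hle x (hfin.mem_toFinset.1 hx) y hy.1)
      ⟨y, hfin.mem_toFinset.2 hy, hlt y hy⟩
  have hconv : convexHull ℝ V ⊆ {y | Φ y ≤ C} :=
    convexHull_min hΦV (convex_halfSpace_le Φ.isLinear C)
  refine ⟨_, Or.inr ⟨Φ, rfl⟩, Set.Subset.antisymm ?_ ?_⟩
  · rintro x ⟨⟨-, hmax⟩, hxV⟩
    by_contra hxS
    obtain ⟨s, hs⟩ := hS
    have := hmax s (subset_convexHull ℝ V (hSV hs))
    rw [hΦS s hs] at this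
    exact (hΦlt x ⟨hxV, hxS⟩).not_ge this
  · intro x hx
    refine ⟨⟨subset_convexHull ℝ V (hSV hx), fun y hy => ?_⟩, hSV hx⟩
    rw [hΦS x hx]
    exact hconv hy

/-- The tensor square of a permutation matrix. -/
def permTensor {n : ℕ} (σ : Equiv.Perm (Fin n)) : Fin n → Fin n → Fin n → Fin n → ℝ :=
  fun i j k l => permMat σ i j * permMat σ k l

theorem QAP_eq_range (n : ℕ) : QAP n = Set.range (permTensor (n := n)) := by
  ext y
  exact ⟨fun ⟨σ, h⟩ => ⟨σ, h.symm⟩, fun ⟨σ, h⟩ => ⟨σ, h.symm⟩⟩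

/-- A single entry of a tensor, as a linear functional. -/
def tensorEntry {n : ℕ} (i j k l : Fin n) :
    (Fin n → Fin n → Fin n → Fin n → ℝ) →ₗ[ℝ] ℝ where
  toFun y := y i j k l
  map_add' _ _ := rfl
  map_smul' _ _ := rfl

theorem tensorEntry_permTensor {n : ℕ} (i j k l : Fin n) (σ : Equiv.Perm (Fin n)) :
    tensorEntry i j k l (permTensor σ) =
      (if σ i = j then 1 else 0) * (if σ k = l then 1 else 0) := rfl

/-- A permutation different from three given ones is cut off from them by a linear functional
on the tensor squares. -/
theorem exists_linearMap_permTensor_lt {n : ℕ} {α β γ τ : Equiv.Perm (Fin n)}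
    (hα : τ ≠ α) (hβ : τ ≠ β) (hγ : τ ≠ γ) :
    ∃ (φ : (Fin n → Fin n → Fin n → Fin n → ℝ) →ₗ[ℝ] ℝ) (c : ℝ),
      (∀ σ, φ (permTensor σ) ≤ c) ∧
      (φ (permTensor α) = c ∧ φ (permTensor β) = c ∧ φ (permTensor γ) = c) ∧
      φ (permTensor τ) < c := by
  by_cases h : ∃ i k, (α k = τ k → α i ≠ τ i) ∧ (β k = τ k → β i ≠ τ i) ∧
      (γ k = τ k → γ i ≠ τ i)
  · obtain ⟨i, k, h₁, h₂, h₃⟩ := h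
    refine ⟨-tensorEntry i (τ i) k (τ k), 0, fun σ => ?_, ⟨?_, ?_, ?_⟩, ?_⟩ <;>
      simp only [LinearMap.neg_apply, tensorEntry_permTensor]
    · split_ifs <;> norm_num
    · simpa using h₁
    · simpa using h₂
    · simpa using h₃
    · simp
  · push Not at h
    obtain ⟨i, hi⟩ : ∃ i, α i ≠ τ i := by
      by_contra! H; exact hα (Equiv.ext fun i => (H i).symm)
    obtain ⟨j, hj⟩ : ∃ j, β j ≠ τ j := by
      by_contra! H; exact hβ (Equiv.ext fun i => (H i).symm)
    obtain ⟨k, hk⟩ : ∃ k, γ k ≠ τ k := by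
      by_contra! H; exact hγ (Equiv.ext fun i => (H i).symm)
    have hαj : α j = τ j := by have := h j k; have := h i j; have := h j i; grind
    have hαk : α k = τ k := by have := h j k; have := h i k; grind
    have hβi : β i = τ i := by have := h i k; have := h i j; grind
    have hβk : β k = τ k := by have := h i k; have := h j k; have := h i j; grind
    have hγi : γ i = τ i := by have := h i j; have := h i k; grind
    have hγj : γ j = τ j := by have := h i j; have := h j k; grind
    -- With `s` the number of agreements with `τ` at `i, j, k`, this functional is `4 - (s - 2) ^ 2`.
    refine ⟨(3 : ℝ) • (tensorEntry i (τ i) i (τ i) + tensorEntry j (τ j) j (τ j) +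
        tensorEntry k (τ k) k (τ k)) - (2 : ℝ) • (tensorEntry i (τ i) j (τ j) +
        tensorEntry i (τ i) k (τ k) + tensorEntry j (τ j) k (τ k)), 4,
      fun σ => ?_, ⟨?_, ?_, ?_⟩, ?_⟩ <;>
      simp only [LinearMap.sub_apply, LinearMap.smul_apply, LinearMap.add_apply,
        tensorEntry_permTensor, smul_eq_mul]
    · split_ifs <;> norm_num
    all_goals simp [*]; try norm_num

/-- `conv QAP(n)` is 3-neighborly: every nonempty set of at most three vertices
is the vertex set of a face. -/
theorem qap_three_neighborly (n : ℕ) (hn : 2 ≤ n) :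
    ∀ S ⊆ QAP n, S.Nonempty → S.ncard ≤ 3 → IsVertexSetOfFace (QAP n) S := by
  intro S hSV hS hcard
  have hV : (QAP n).Finite := QAP_eq_range n ▸ Set.finite_range _
  have hSfin : S.Finite := hV.subset hSV
  obtain ⟨a, b, c, rfl⟩ : ∃ a b c, S = {a, b, c} := by
    have hpos := (Set.ncard_pos hSfin).2 hS
    obtain h | h | h : S.ncard = 1 ∨ S.ncard = 2 ∨ S.ncard = 3 := by omega
    · obtain ⟨a, rfl⟩ := Set.ncard_eq_one.1 h
      exact ⟨a, a, a, by simp⟩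
    · obtain ⟨a, b, -, rfl⟩ := Set.ncard_eq_two.1 h
      exact ⟨a, b, b, by simp⟩
    · obtain ⟨a, b, c, -, -, -, rfl⟩ := Set.ncard_eq_three.1 h
      exact ⟨a, b, c, rfl⟩
  refine isVertexSetOfFace_of_forall_exists_lt hV hSV hS ?_
  rw [QAP_eq_range] at hSV ⊢
  obtain ⟨α, rfl⟩ := hSV (show a ∈ _ by simp)
  obtain ⟨β, rfl⟩ := hSV (show b ∈ _ by simp)
  obtain ⟨γ, rfl⟩ := hSV (show c ∈ _ by simp)
  rintro _ ⟨⟨τ, rfl⟩, hτ⟩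
  obtain ⟨φ, c, hle, ⟨h₁, h₂, h₃⟩, hlt⟩ := exists_linearMap_permTensor_lt
    (α := α) (β := β) (γ := γ) (τ := τ) (by rintro rfl; simp at hτ) (by rintro rfl; simp at hτ)
    (by rintro rfl; simp at hτ)
  refine ⟨φ, c, Set.forall_mem_range.2 hle, ?_, hlt⟩
  rintro y (rfl | rfl | rfl) <;> assumption
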